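/- Suppose the characteristic of the field F is not 2. Then every symmetric n×n matrix X over F is U-congruent to a unique sub-permutation matrix; that is, there is exactly one sub-permutation matrix Y such that Y = h'Xh for some h ∈ U. -/

import Mathlib

open Matrix

variable {F : Type*} [Field F] {n : ℕ}

/-- Membership in `U`: upper triangular matrices with all diagonal entries 1. -/
def InU (h : Matrix (Fin n) (Fin n) F) : Prop :=
  (∀ i, h i i = 1) ∧ ∀ i j : Fin n, j < i → h i j = 0

/-- A sub-permutation matrix: at most one nonzero entry in every row and column. -/
def SubPerm (Y : Matrix (Fin n) (Fin n) F) : Prop :=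
  (∀ i j k : Fin n, Y i j ≠ 0 → Y i k ≠ 0 → j = k) ∧
  (∀ i j k : Fin n, Y i k ≠ 0 → Y j k ≠ 0 → i = j)

lemma InU.one : InU (1 : Matrix (Fin n) (Fin n) F) :=
  ⟨fun i => one_apply_eq i, fun _ _ hij => one_apply_ne hij.ne'⟩

lemma InU.mul {g h : Matrix (Fin n) (Fin n) F} (hg : InU g) (hh : InU h) : InU (g * h) := by
  refine ⟨fun i => ?_, fun i j hij => ?_⟩
  · rw [mul_apply, Finset.sum_eq_single i, hg.1, hh.1, one_mul]
    · intro k _ hk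
      rcases hk.lt_or_gt with hk | hk
      · rw [hg.2 i k hk, zero_mul]
      · rw [hh.2 k i hk, mul_zero]
    · simp
  · rw [mul_apply]
    refine Finset.sum_eq_zero fun k _ => ?_
    rcases lt_or_ge k i with hk | hk
    · rw [hg.2 i k hk, zero_mul]
    · rw [hh.2 k j (hij.trans_le hk), mul_zero]

lemma InU.isUnit_det {h : Matrix (Fin n) (Fin n) F} (hh : InU h) : IsUnit h.det := by
  rw [det_of_isUpperTriangular (fun i j hij => hh.2 i j hij)]
  simp [hh.1]

lemma InU.inv {h : Matrix (Fin n) (Fin n) F} (hh : InU h) : InU h⁻¹ := by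
  have : Invertible h := invertibleOfIsUnitDet h hh.isUnit_det
  have hT : BlockTriangular h⁻¹ id :=
    blockTriangular_inv_of_blockTriangular (fun i j hij => hh.2 i j hij)
  refine ⟨fun i => ?_, fun i j hij => hT hij⟩
  have key : (h * h⁻¹) i i = 1 := by
    rw [mul_nonsing_inv _ hh.isUnit_det, one_apply_eq]
  rw [mul_apply, Finset.sum_eq_single i, hh.1, one_mul] at key
  · exact key
  · intro k _ hk
    rcases hk.lt_or_gt with hk | hk
    · rw [hh.2 i k hk, zero_mul]
    · rw [hT hk, mul_zero]
  · simp

/-- Congruence by an upper unitriangular matrix. -/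
def UCongr (X Y : Matrix (Fin n) (Fin n) F) : Prop :=
  ∃ h : Matrix (Fin n) (Fin n) F, InU h ∧ Y = hᵀ * X * h

lemma UCongr.refl (X : Matrix (Fin n) (Fin n) F) : UCongr X X :=
  ⟨1, InU.one, by simp⟩

lemma UCongr.trans {X Y Z : Matrix (Fin n) (Fin n) F} (hXY : UCongr X Y) (hYZ : UCongr Y Z) :
    UCongr X Z := by
  obtain ⟨g, hg, rfl⟩ := hXY
  obtain ⟨h, hh, rfl⟩ := hYZ
  exact ⟨g * h, hg.mul hh, by simp only [transpose_mul, Matrix.mul_assoc]⟩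

lemma UCongr.symm {X Y : Matrix (Fin n) (Fin n) F} (hXY : UCongr X Y) : UCongr Y X := by
  obtain ⟨g, hg, rfl⟩ := hXY
  refine ⟨g⁻¹, hg.inv, ?_⟩
  have h₁ : g * g⁻¹ = 1 := mul_nonsing_inv _ hg.isUnit_det
  have h₂ : (g⁻¹)ᵀ * gᵀ = 1 := by rw [← transpose_mul, h₁, transpose_one]
  calc X = ((g⁻¹)ᵀ * gᵀ) * X * (g * g⁻¹) := by rw [h₁, h₂, Matrix.one_mul, Matrix.mul_one]
    _ = _ := by simp only [Matrix.mul_assoc]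

lemma UCongr.isSymm {X Y : Matrix (Fin n) (Fin n) F} (hXY : UCongr X Y) (hX : X.IsSymm) :
    Y.IsSymm := by
  obtain ⟨g, -, rfl⟩ := hXY
  simp only [Matrix.IsSymm, transpose_mul, transpose_transpose, hX.eq, Matrix.mul_assoc]

lemma SubPerm.eq_of_mul_eq_mul {Y Z g h : Matrix (Fin n) (Fin n) F} (hY : SubPerm Y)
    (hZ : SubPerm Z) (hg : InU g) (hh : InU h) (hYZ : gᵀ * Z = Y * h) (i : Fin n) :
    ∀ j, Y i j ≠ 0 → Z i j = Y i j := by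
  induction i using WellFoundedLT.induction with
  | ind i ih =>
  intro j hij
  have hentry : ∀ a b, ∑ l, g l a * Z l b = ∑ l, Y a l * h l b := fun a b => by
    simpa [mul_apply] using congrFun (congrFun hYZ a) b
  have hYh : ∑ l, Y i l * h l j = Y i j := by
    rw [Finset.sum_eq_single j, hh.1, mul_one]
    · intro k _ hk
      rw [not_not.mp fun hik => hk (hY.1 i k j hik hij), zero_mul]
    · simp
  obtain ⟨l, -, hl⟩ := Finset.exists_ne_zero_of_sum_ne_zero ((hentry i j).trans hYh ▸ hij)
  have hlj : Z l j ≠ 0 := right_ne_zero_of_mul hl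
  have hgZ : ∀ a, ∑ l, g l a * Z l j = g l a * Z l j := fun a => by
    refine Finset.sum_eq_single l (fun k _ hk => ?_) (by simp)
    rw [not_not.mp fun hkj => hk (hZ.2 k l j hkj hlj), mul_zero]
  have hli : l ≤ i := not_lt.mp fun hil => left_ne_zero_of_mul hl (hg.2 l i hil)
  rcases hli.lt_or_eq with hli | rfl
  · have hne : ∑ k, Y l k * h k j ≠ 0 := by
      rw [← hentry, hgZ, hg.1, one_mul]
      exact hlj
    obtain ⟨k, -, hk⟩ := Finset.exists_ne_zero_of_sum_ne_zero hne
    have hlk := left_ne_zero_of_mul hk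
    have hkj : k = j := hZ.1 l k j (ih l hli k hlk ▸ hlk) hlj
    exact absurd (hY.2 l i j (hkj ▸ hlk) hij) hli.ne
  · rw [← hYh, ← hentry, hgZ, hg.1, one_mul]

lemma SubPerm.eq_of_uCongr {Y Z : Matrix (Fin n) (Fin n) F} (hY : SubPerm Y) (hZ : SubPerm Z)
    (hYZ : UCongr Y Z) : Y = Z := by
  have key : ∀ {Y Z : Matrix (Fin n) (Fin n) F}, SubPerm Y → SubPerm Z → UCongr Y Z →
      ∀ i j, Y i j ≠ 0 → Z i j = Y i j := by
    rintro Y Z hY hZ ⟨g, hg, rfl⟩ i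
    refine hY.eq_of_mul_eq_mul hZ hg.inv hg ?_ i
    rw [← Matrix.mul_assoc, ← Matrix.mul_assoc, ← transpose_mul,
      mul_nonsing_inv _ hg.isUnit_det, transpose_one, Matrix.one_mul]
  ext i j
  by_cases hij : Y i j = 0
  · by_contra hne
    exact hne (key hZ hY hYZ.symm i j fun h0 => hne (hij.trans h0.symm))
  · exact (key hY hZ hYZ i j hij).symm

/-- Subtracting multiples of the basis vectors `j` and `p` from later basis vectors. -/
lemma uCongr_sub_two_rows (X : Matrix (Fin n) (Fin n) F) (p j : Fin n) (α β : Fin n → F)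
    (hα : ∀ k, k ≤ j → α k = 0) (hβ : ∀ k, k ≤ p → β k = 0) :
    UCongr X (of fun i k => X i k - X i j * α k - X i p * β k
      - α i * (X j k - X j j * α k - X j p * β k)
      - β i * (X p k - X p j * α k - X p p * β k)) := by
  have hcol : ∀ (M : Matrix (Fin n) (Fin n) F) i k,
      (M * (1 - vecMulVec (Pi.single j 1) α - vecMulVec (Pi.single p 1) β)) i k =
        M i k - M i j * α k - M i p * β k := fun M i k => by
    simp [Matrix.mul_sub, mul_vecMulVec, vecMulVec_apply]
  refine ⟨1 - vecMulVec (Pi.single j 1) α - vecMulVec (Pi.single p 1) β, ⟨fun i => ?_,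
    fun i k hki => ?_⟩, ?_⟩
  · have h₁ : (Pi.single j 1 : Fin n → F) i * α i = 0 := by
      rcases eq_or_ne i j with rfl | hij
      · rw [hα i le_rfl, mul_zero]
      · rw [Pi.single_eq_of_ne hij, zero_mul]
    have h₂ : (Pi.single p 1 : Fin n → F) i * β i = 0 := by
      rcases eq_or_ne i p with rfl | hip
      · rw [hβ i le_rfl, mul_zero]
      · rw [Pi.single_eq_of_ne hip, zero_mul]
    simp [vecMulVec_apply, h₁, h₂]
  · have h₁ : (Pi.single j 1 : Fin n → F) i * α k = 0 := by
      rcases eq_or_ne i j with rfl | hij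
      · rw [hα k hki.le, mul_zero]
      · rw [Pi.single_eq_of_ne hij, zero_mul]
    have h₂ : (Pi.single p 1 : Fin n → F) i * β k = 0 := by
      rcases eq_or_ne i p with rfl | hip
      · rw [hβ k hki.le, mul_zero]
      · rw [Pi.single_eq_of_ne hip, zero_mul]
    simp [vecMulVec_apply, h₁, h₂, one_apply_ne hki.ne']
  · ext i k
    rw [Matrix.mul_assoc, ← transpose_apply (_ * _), transpose_mul, transpose_transpose, hcol]
    simp only [transpose_apply, hcol, of_apply]
    ring

/-- The rows of `X` indexed by `S` are supported in `S` and have at most one nonzero entry. -/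
def ReducedOn (X : Matrix (Fin n) (Fin n) F) (S : Finset (Fin n)) : Prop :=
  ∀ i ∈ S, (∀ j, X i j ≠ 0 → j ∈ S) ∧ ∀ j k, X i j ≠ 0 → X i k ≠ 0 → j = k

lemma ReducedOn.exists_ssuperset (hchar : (2 : F) ≠ 0) {X : Matrix (Fin n) (Fin n) F}
    (hX : X.IsSymm) {S : Finset (Fin n)} (hS : ReducedOn X S) (hne : S ≠ Finset.univ) :
    ∃ Y T, UCongr X Y ∧ S ⊂ T ∧ ReducedOn Y T := by
  obtain ⟨p, hpS, hpmin⟩ : ∃ p, p ∉ S ∧ ∀ k, k ∉ S → p ≤ k := by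
    obtain ⟨q, hq⟩ : ∃ q, q ∉ S := by
      by_contra! h
      exact hne (Finset.eq_univ_iff_forall.mpr h)
    obtain ⟨p, hp, hmin⟩ := WellFounded.has_min (wellFounded_lt (α := Fin n)) {k | k ∉ S} ⟨q, hq⟩
    exact ⟨p, hp, fun k hk => not_lt.mp (hmin k hk)⟩
  have hsymm : ∀ i k, X i k = X k i := fun i k => hX.apply k i
  have hzero : ∀ i k, i ∈ S → k ∉ S → X i k = 0 := fun i k hi hk =>
    not_not.mp fun h => hk ((hS i hi).1 k h)
  by_cases hrow : ∀ k, X p k = 0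
  · refine ⟨X, insert p S, UCongr.refl X, Finset.ssubset_insert hpS, fun i hi => ?_⟩
    rcases Finset.mem_insert.mp hi with rfl | hi
    · exact ⟨fun k hk => absurd (hrow k) hk, fun k _ hk => absurd (hrow k) hk⟩
    · exact ⟨fun k hk => Finset.mem_insert_of_mem ((hS i hi).1 k hk), (hS i hi).2⟩
  obtain ⟨j, hpj, hjmin⟩ : ∃ j, X p j ≠ 0 ∧ ∀ k, k < j → X p k = 0 := by
    push Not at hrow
    obtain ⟨j, hj, hmin⟩ := WellFounded.has_min (wellFounded_lt (α := Fin n)) {k | X p k ≠ 0} hrow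
    exact ⟨j, hj, fun k hk => not_not.mp fun h => hmin k h hk⟩
  have hjS : j ∉ S := fun hj => hpj (by rw [hsymm, hzero j p hj hpS])
  rcases (hpmin j hjS).eq_or_lt with rfl | hlt
  · refine ⟨_, insert p S, uCongr_sub_two_rows X p p (fun k => if k = p then 0 else X p k / X p p)
      0 (fun k hk => ?_) (fun _ _ => rfl), Finset.ssubset_insert hpS, fun i hi => ?_⟩
    · rcases hk.eq_or_lt with rfl | hk
      · simp
      · simp [hjmin k hk]
    rcases Finset.mem_insert.mp hi with rfl | hi
    · have hoff : ∀ k, k ≠ i → X i k - X i i * (X i k / X i i) = 0 := fun k _ => by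
        field_simp
        ring
      constructor
      · intro k hk
        by_cases hki : k = i
        · exact hki ▸ hi
        · simp [hki, hoff k hki] at hk
      · intro k l hk hl
        have hk : k = i := by
          by_contra hki
          simp [hki, hoff k hki] at hk
        have hl : l = i := by
          by_contra hli
          simp [hli, hoff l hli] at hl
        rw [hk, hl]
    · have hip := hzero i p hi hpS
      have hpi : X p i = 0 := by rw [hsymm, hip]
      simp only [of_apply, Pi.zero_apply, hip, hpi, zero_div, ite_self, zero_mul, sub_zero]
      exact ⟨fun k hk => Finset.mem_insert_of_mem ((hS i hi).1 k hk), (hS i hi).2⟩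
  · set α : Fin n → F := fun k => if k = p ∨ k = j then 0 else X p k / X p j with hα
    set β : Fin n → F := fun k => if k = p then 0 else if k = j then X j j / (2 * X p j)
      else (X j k - α k * X j j) / X p j with hβ
    have hαS : ∀ i ∈ S, α i = 0 := fun i hi => by
      simp [hα, hsymm p i, hzero i p hi hpS]
    have hβS : ∀ i ∈ S, β i = 0 := fun i hi => by
      have hij : i ≠ j := fun h => hjS (h ▸ hi)
      simp [hβ, hij, hαS i hi, hsymm j i, hzero i j hi hjS]
    have hpp : X p p = 0 := hjmin p hlt
    have hαp : α p = 0 := by simp [hα]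
    have hαj : α j = 0 := by simp [hα]
    have hβp : β p = 0 := by simp [hβ]
    have hβj : β j = X j j / (2 * X p j) := by simp [hβ, hlt.ne']
    have hα' : ∀ k, k ≠ p → k ≠ j → X p k - X p j * α k = 0 := fun k hkp hkj => by
      simp only [hα, hkp, hkj, or_self, if_false]
      field_simp
      ring
    have hβ' : ∀ k, k ≠ p → k ≠ j → X j k - X j j * α k - X p j * β k = 0 := fun k hkp hkj => by
      simp only [hβ, hkp, hkj, if_false]
      field_simp
      ring
    refine ⟨_, insert j (insert p S), uCongr_sub_two_rows X p j α β (fun k hk => ?_)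
      (fun k hk => ?_), (Finset.ssubset_insert hpS).trans_subset (Finset.subset_insert _ _),
      fun i hi => ?_⟩
    · rcases hk.eq_or_lt with rfl | hk
      · exact hαj
      · simp [hα, hjmin k hk]
    · rcases hk.eq_or_lt with rfl | hk
      · exact hβp
      · exact hβS k (not_not.mp fun h => (hpmin k h).not_gt hk)
    have hsingle : ∀ (r : Fin n → F) (m : Fin n), m ∈ insert j (insert p S) →
        (∀ k, k ≠ m → r k = 0) →
        (∀ k, r k ≠ 0 → k ∈ insert j (insert p S)) ∧ ∀ k l, r k ≠ 0 → r l ≠ 0 → k = l := by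
      intro r m hm hr
      have hr' : ∀ k, r k ≠ 0 → k = m := fun k hk => by_contra fun h => hk (hr k h)
      exact ⟨fun k hk => hr' k hk ▸ hm, fun k l hk hl => (hr' k hk).trans (hr' l hl).symm⟩
    rcases Finset.mem_insert.mp hi with rfl | hi
    · refine hsingle _ p (by simp) fun k hkp => ?_
      rcases eq_or_ne k i with rfl | hki
      · simp only [of_apply, hαj, hβj, hpp, hsymm k p]
        field_simp
        ring
      · simp only [of_apply, hαj, hpp, hsymm i p]
        linear_combination hβ' k hkp hki - β i * hα' k hkp hki
    rcases Finset.mem_insert.mp hi with rfl | hi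
    · refine hsingle _ j (by simp) fun k hkj => ?_
      rcases eq_or_ne k i with rfl | hki
      · simp [hαp, hβp, hpp]
      · simp only [of_apply, hαp, hβp, hpp]
        linear_combination hα' k hki hkj
    · simp only [of_apply, hzero i p hi hpS, hzero i j hi hjS, hαS i hi, hβS i hi, zero_mul,
        sub_zero]
      exact ⟨fun k hk => by simp [(hS i hi).1 k hk], (hS i hi).2⟩

lemma ReducedOn.exists_univ (hchar : (2 : F) ≠ 0) {X : Matrix (Fin n) (Fin n) F}
    (hX : X.IsSymm) {S : Finset (Fin n)} (hS : ReducedOn X S) :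
    ∃ Y, UCongr X Y ∧ ReducedOn Y Finset.univ := by
  induction S using WellFoundedGT.induction generalizing X with
  | ind S ih =>
  by_cases hne : S = Finset.univ
  · exact ⟨X, UCongr.refl X, hne ▸ hS⟩
  obtain ⟨Y, T, hXY, hST, hT⟩ := hS.exists_ssuperset hchar hX hne
  obtain ⟨Z, hYZ, hZ⟩ := ih T hST (hXY.isSymm hX) hT
  exact ⟨Z, hXY.trans hYZ, hZ⟩

/-- If `char F ≠ 2`, every symmetric matrix is `U`-congruent to a unique
sub-permutation matrix. -/
theorem symm_unique_subperm_U_congruent (hn : 2 ≤ n) (hchar : (2 : F) ≠ 0)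
    (X : Matrix (Fin n) (Fin n) F) (hX : X.IsSymm) :
    ∃! Y : Matrix (Fin n) (Fin n) F, SubPerm Y ∧
      ∃ h : Matrix (Fin n) (Fin n) F, InU h ∧ Y = hᵀ * X * h := by
  obtain ⟨Y, hXY, hY⟩ := ReducedOn.exists_univ hchar hX (S := ∅) (by simp [ReducedOn])
  have hrow : ∀ i j k, Y i j ≠ 0 → Y i k ≠ 0 → j = k := fun i => (hY i (Finset.mem_univ i)).2
  have hsub : SubPerm Y := by
    refine ⟨hrow, fun i j k hik hjk => hrow k i j ?_ ?_⟩
    · rwa [(hXY.isSymm hX).apply]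
    · rwa [(hXY.isSymm hX).apply]
  exact ⟨Y, ⟨hsub, hXY⟩, fun Z hZ =>
    hZ.1.eq_of_uCongr hsub (UCongr.trans (UCongr.symm hZ.2) hXY)⟩
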